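/- For n ≥ 2, let (i,j) and (k,l) be pairs of distinct elements of {1,...,n}. If σ_{ij} and σ_{kl} are incomparable in the Bruhat order on S_n (neither σ_{ij} ≤ σ_{kl} nor σ_{kl} ≤ σ_{ij}), then j - i ≠ l - k (the corresponding roots have different heights). -/

import Mathlib

/-- `sigmaSpec n hn i j σ` says that `σ` is the permutation of `Fin n` (representing
`{1,...,n}`) whose one-line notation lists the elements of `{1,...,n} \ {i,j}` in
decreasing order in the first `n-2` positions, followed by `i` and then `j`. -/
def sigmaSpec (n : ℕ) (hn : 2 ≤ n) (i j : Fin n) (σ : Equiv.Perm (Fin n)) : Prop :=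
  σ ⟨n - 2, by omega⟩ = i ∧ σ ⟨n - 1, by omega⟩ = j ∧
    ∀ p q : Fin n, p < q → (q : ℕ) < n - 2 → σ q < σ p

/-- The number of inversions of a permutation of `Fin n`. -/
def inversions {n : ℕ} (u : Equiv.Perm (Fin n)) : ℕ :=
  (Finset.univ.filter fun p : Fin n × Fin n => p.1 < p.2 ∧ u p.2 < u p.1).card

/-- Bruhat order: `u ≤ w` iff there is a chain from `u` to `w`, each step multiplying by a
transposition and strictly increasing the number of inversions. -/
def bruhatLE {n : ℕ} (u w : Equiv.Perm (Fin n)) : Prop :=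
  Relation.ReflTransGen
    (fun x y => (∃ t : Equiv.Perm (Fin n), t.IsSwap ∧ y = x * t) ∧
      inversions x < inversions y) u w

/-- Exchanging the consecutive values `a` and `b = a + 1` in `x` goes up in the Bruhat order
when `a` occurs before `b`. -/
theorem bruhatLE_swap_mul {n : ℕ} {x : Equiv.Perm (Fin n)} {a b : Fin n}
    (hab : (b : ℕ) = a + 1) (hx : x.symm a < x.symm b) :
    bruhatLE x (Equiv.swap a b * x) := by
  have hne : a ≠ b := fun h => by simp [h] at hab
  refine Relation.ReflTransGen.single
    ⟨⟨Equiv.swap (x.symm a) (x.symm b), ⟨_, _, x.symm.injective.ne hne, rfl⟩, ?_⟩, ?_⟩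
  · rw [Equiv.mul_swap_eq_swap_mul]
    simp
  · refine Finset.card_lt_card (Finset.ssubset_iff_of_subset ?_ |>.2
      ⟨(x.symm a, x.symm b), ?_, ?_⟩)
    · rintro ⟨p, q⟩ h
      rw [Finset.mem_filter_univ] at h ⊢
      simp only [Equiv.Perm.mul_apply] at h ⊢
      refine ⟨h.1, ?_⟩
      have key : ¬ (x p = b ∧ x q = a) := by
        rintro ⟨rfl, rfl⟩
        simp only [Equiv.symm_apply_apply] at hx
        exact lt_asymm hx h.1
      have h2 := h.2
      simp only [Equiv.swap_apply_def]
      grind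
    · rw [Finset.mem_filter_univ]
      simp only [Equiv.Perm.mul_apply, Equiv.apply_symm_apply, Equiv.swap_apply_left,
        Equiv.swap_apply_right]
      exact ⟨hx, by omega⟩
    · rw [Finset.mem_filter_univ]
      simp only [Equiv.apply_symm_apply]
      omega

/-- Exchanging the values `a` and `b = a + 1` in `σ` goes down in the Bruhat order
when `b` occurs before `a`. -/
theorem swap_mul_bruhatLE {n : ℕ} {σ : Equiv.Perm (Fin n)} {a b : Fin n}
    (hab : (b : ℕ) = a + 1) (h : σ.symm b < σ.symm a) :
    bruhatLE (Equiv.swap a b * σ) σ := by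
  have := bruhatLE_swap_mul (x := Equiv.swap a b * σ) hab
    (by simpa [Equiv.Perm.mul_def, Equiv.symm_trans_apply] using h)
  simpa [← mul_assoc] using this

theorem sigmaSpec.apply_ne {n : ℕ} {hn : 2 ≤ n} {i j : Fin n} {σ : Equiv.Perm (Fin n)}
    (h : sigmaSpec n hn i j σ) {p : Fin n} (hp : (p : ℕ) < n - 2) : σ p ≠ i ∧ σ p ≠ j := by
  obtain ⟨rfl, rfl, -⟩ := h
  constructor <;> refine σ.injective.ne fun h => ?_ <;> simp only [Fin.ext_iff] at h <;> omega

theorem sigmaSpec.symm_lt {n : ℕ} {hn : 2 ≤ n} {i j a : Fin n} {σ : Equiv.Perm (Fin n)}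
    (h : sigmaSpec n hn i j σ) (hi : a ≠ i) (hj : a ≠ j) : (σ.symm a : ℕ) < n - 2 := by
  obtain ⟨rfl, rfl, -⟩ := h
  rw [Ne, ← Equiv.symm_apply_eq, Fin.ext_iff] at hi hj
  have := (σ.symm a).isLt
  simp only at hi hj
  omega

/-- The last two one-line entries determine `σ`. -/
theorem sigmaSpec.unique {n : ℕ} {hn : 2 ≤ n} {i j : Fin n} {σ τ : Equiv.Perm (Fin n)}
    (hσ : sigmaSpec n hn i j σ) (hτ : sigmaSpec n hn i j τ) : σ = τ := by
  have hlt : ∀ p : Fin n, (p : ℕ) < n - 2 → (σ.symm (τ p) : ℕ) < n - 2 := fun p hp =>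
    hσ.symm_lt (hτ.apply_ne hp).1 (hτ.apply_ne hp).2
  have hi : σ.symm (τ ⟨n - 2, by omega⟩) = ⟨n - 2, by omega⟩ := by
    rw [hτ.1, Equiv.symm_apply_eq, hσ.1]
  have hj : σ.symm (τ ⟨n - 1, by omega⟩) = ⟨n - 1, by omega⟩ := by
    rw [hτ.2.1, Equiv.symm_apply_eq, hσ.2.1]
  have hmono : StrictMono fun p => σ.symm (τ p) := by
    intro p q hpq
    by_cases hq : (q : ℕ) < n - 2
    · by_contra! hle
      have hp : (p : ℕ) < n - 2 := by omega
      have h1 := hτ.2.2 p q hpq hq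
      rcases hle.lt_or_eq with hlt' | heq
      · have h2 := hσ.2.2 _ _ hlt' (hlt p hp)
        simp only [Equiv.apply_symm_apply] at h2
        exact lt_asymm h1 h2
      · exact hpq.ne' (τ.injective (σ.symm.injective heq))
    · by_cases hp : (p : ℕ) < n - 2
      · have h1 := hlt p hp
        obtain h | h : q = ⟨n - 2, by omega⟩ ∨ q = ⟨n - 1, by omega⟩ := by
          simp only [Fin.ext_iff]; omega
        · simp only [h, hi, Fin.lt_def]; omega
        · simp only [h, hj, Fin.lt_def]; omega
      · have hp' : p = ⟨n - 2, by omega⟩ := by simp only [Fin.ext_iff]; omega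
        have hq' : q = ⟨n - 1, by omega⟩ := by
          rw [Fin.lt_def] at hpq; simp only [Fin.ext_iff]; omega
        simpa only [hp', hq', hi, hj] using hpq
  have hid := (hmono.range_inj strictMono_id).1 (by
    rw [Set.range_id]
    exact (τ.trans σ.symm).surjective.range_eq)
  ext p : 1
  have := congrFun hid p
  rw [id, Equiv.symm_apply_eq] at this
  exact this.symm

theorem sigmaSpec.swap_left {n : ℕ} {hn : 2 ≤ n} {i j i' : Fin n} {σ : Equiv.Perm (Fin n)}
    (h : sigmaSpec n hn i j σ) (hij : i ≠ j) (hi' : (i' : ℕ) = i + 1) (hne : i' ≠ j) :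
    sigmaSpec n hn i' j (Equiv.swap i i' * σ) ∧ bruhatLE (Equiv.swap i i' * σ) σ := by
  refine ⟨⟨?_, ?_, fun p q hpq hq => ?_⟩, swap_mul_bruhatLE hi' ?_⟩
  · simp [h.1]
  · simp [h.2.1, Equiv.swap_apply_of_ne_of_ne hij.symm hne.symm]
  · have hp := h.apply_ne (p := p) (by omega)
    have hq' := h.apply_ne hq
    have := h.2.2 p q hpq hq
    simp only [Equiv.Perm.mul_apply, Equiv.swap_apply_def]
    grind
  · have := h.symm_lt (a := i') (fun h => by simp [h] at hi') hne
    rw [← h.1, Equiv.symm_apply_apply, Fin.lt_def]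
    exact this

theorem sigmaSpec.swap_right {n : ℕ} {hn : 2 ≤ n} {i j j' : Fin n} {σ : Equiv.Perm (Fin n)}
    (h : sigmaSpec n hn i j σ) (hij : i ≠ j) (hj' : (j' : ℕ) = j + 1) (hne : j' ≠ i) :
    sigmaSpec n hn i j' (Equiv.swap j j' * σ) ∧ bruhatLE (Equiv.swap j j' * σ) σ := by
  refine ⟨⟨?_, ?_, fun p q hpq hq => ?_⟩, swap_mul_bruhatLE hj' ?_⟩
  · simp [h.1, Equiv.swap_apply_of_ne_of_ne hij hne.symm]
  · simp [h.2.1]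
  · have hp := h.apply_ne (p := p) (by omega)
    have hq' := h.apply_ne hq
    have := h.2.2 p q hpq hq
    simp only [Equiv.Perm.mul_apply, Equiv.swap_apply_def]
    grind
  · have := h.symm_lt (a := j') hne (fun h => by simp [h] at hj')
    rw [← h.2.1, Equiv.symm_apply_apply, Fin.lt_def]
    simp only
    omega

theorem sigmaSpec.exists_succ {n : ℕ} {hn : 2 ≤ n} {i j i' j' : Fin n} {σ : Equiv.Perm (Fin n)}
    (h : sigmaSpec n hn i j σ) (hij : i ≠ j) (hi' : (i' : ℕ) = i + 1) (hj' : (j' : ℕ) = j + 1) :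
    ∃ τ, sigmaSpec n hn i' j' τ ∧ bruhatLE τ σ := by
  have hne' : j' ≠ i' := by rw [Ne, Fin.ext_iff] at *; omega
  by_cases hne : i' = j
  · have hji : j' ≠ i := by rw [Ne, Fin.ext_iff] at *; omega
    obtain ⟨h1, le1⟩ := h.swap_right hij hj' hji
    obtain ⟨h2, le2⟩ := h1.swap_left hji.symm hi' hne'.symm
    exact ⟨_, h2, le2.trans le1⟩
  · obtain ⟨h1, le1⟩ := h.swap_left hij hi' hne
    obtain ⟨h2, le2⟩ := h1.swap_right hne hj' hne'
    exact ⟨_, h2, le2.trans le1⟩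

/-- Translating both indices up by `d` goes down in the Bruhat order. -/
theorem sigmaSpec.bruhatLE_of_add {n : ℕ} {hn : 2 ≤ n} {k l : Fin n} {τ : Equiv.Perm (Fin n)}
    (hτ : sigmaSpec n hn k l τ) (d : ℕ) {i j : Fin n} {σ : Equiv.Perm (Fin n)}
    (hσ : sigmaSpec n hn i j σ) (hij : i ≠ j) (hk : (k : ℕ) = i + d) (hl : (l : ℕ) = j + d) :
    bruhatLE τ σ := by
  induction d generalizing i j σ with
  | zero =>
    obtain rfl : k = i := Fin.ext hk
    obtain rfl : l = j := Fin.ext hl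
    rw [hτ.unique hσ]
    exact Relation.ReflTransGen.refl
  | succ d ih =>
    obtain ⟨ρ, hρ, hle⟩ := hσ.exists_succ (i' := ⟨i + 1, by omega⟩) (j' := ⟨j + 1, by omega⟩)
      hij rfl rfl
    have hne : (⟨i + 1, by omega⟩ : Fin n) ≠ ⟨j + 1, by omega⟩ := by
      rw [Ne, Fin.ext_iff] at *; simp only; omega
    exact (ih hρ hne (by simp only; omega) (by simp only; omega)).trans hle

/-- If `σ_{ij}` and `σ_{kl}` are incomparable in the Bruhat order, then the corresponding
roots have different heights: `j - i ≠ l - k`. -/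
theorem height_ne_of_incomparable (n : ℕ) (hn : 2 ≤ n)
    (i j k l : Fin n) (hij : i ≠ j) (hkl : k ≠ l)
    (σ₁ σ₂ : Equiv.Perm (Fin n))
    (h₁ : sigmaSpec n hn i j σ₁) (h₂ : sigmaSpec n hn k l σ₂)
    (hinc : ¬ bruhatLE σ₁ σ₂ ∧ ¬ bruhatLE σ₂ σ₁) :
    (j : ℤ) - (i : ℤ) ≠ (l : ℤ) - (k : ℤ) := by
  intro heq
  rcases le_total (i : ℕ) k with hik | hki
  · exact hinc.2 (h₂.bruhatLE_of_add (k - i) h₁ hij (by omega) (by omega))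
  · exact hinc.1 (h₁.bruhatLE_of_add (i - k) h₂ hkl (by omega) (by omega))
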